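/- Let Y be a finite-dimensional vector space over ℚ_p and let F : Y → Y be a linear automorphism of Y. Suppose L' ⊆ L ⊆ Y are ℤ_p-lattices in Y (i.e., finitely generated ℤ_p-submodules that span Y over ℚ_p) such that F maps L' into L. Then the p-adic absolute value of the determinant of F satisfies |det F|_p = |coker(F : L' → L)|⁻¹ · |L/L'|, where coker(F : L' → L) = L / F(L'), and both L/F(L') and L/L' are finite groups. -/

import Mathlib

theorem PadicInt.card_quotient_span_singleton {p : ℕ} [Fact p.Prime] {x : ℤ_[p]} (hx : x ≠ 0) :
    Finite (ℤ_[p] ⧸ Ideal.span {x}) ∧ ‖x‖ = (Nat.card (ℤ_[p] ⧸ Ideal.span {x}) : ℝ)⁻¹ := by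
  have hspan : Ideal.span {x} = RingHom.ker (PadicInt.toZModPow (p := p) x.valuation) := by
    rw [PadicInt.ker_toZModPow, Ideal.span_singleton_eq_span_singleton]
    exact Associated.symm ⟨PadicInt.unitCoeff hx, by
      rw [mul_comm]; exact (PadicInt.unitCoeff_spec hx).symm⟩
  have e : (ℤ_[p] ⧸ Ideal.span {x}) ≃+* ZMod (p ^ x.valuation) :=
    (Ideal.quotEquivOfEq hspan).trans
      (RingHom.quotientKerEquivOfSurjective (ZMod.ringHom_surjective _))
  have : NeZero (p ^ x.valuation) := ⟨pow_ne_zero _ (Fact.out : p.Prime).ne_zero⟩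
  refine ⟨Finite.of_equiv _ e.symm.toEquiv, ?_⟩
  rw [Nat.card_congr e.toEquiv, Nat.card_zmod, PadicInt.norm_eq_zpow_neg_valuation hx]
  simp

open Module in
/-- The index of a full-rank submodule of a free `ℤ_[p]`-module is the inverse of the `p`-adic
norm of the determinant of a change of basis. -/
theorem Submodule.card_quotient_eq_norm_det_basis_change {p : ℕ} [Fact p.Prime]
    {M : Type*} [AddCommGroup M] [Module ℤ_[p] M] {ι : Type*} [Fintype ι] [DecidableEq ι]
    (b : Basis ι ℤ_[p] M) (N : Submodule ℤ_[p] M) (bN : Basis ι ℤ_[p] N) :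
    Finite (M ⧸ N) ∧ ‖b.det ((↑) ∘ bN)‖ = (Nat.card (M ⧸ N) : ℝ)⁻¹ := by
  have h : finrank ℤ_[p] N = finrank ℤ_[p] M := by
    rw [finrank_eq_card_basis b, finrank_eq_card_basis bN]
  let a := smithNormalFormCoeffs b h
  let b' := smithNormalFormTopBasis b h
  let ab := smithNormalFormBotBasis b h
  have ab_eq := smithNormalFormBotBasis_def b h
  let f : M →ₗ[ℤ_[p]] M := N.subtype ∘ₗ (b'.equiv ab (Equiv.refl _)).toLinearMap
  have ha (i) : f (b' i) = a i • b' i := by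
    rw [LinearMap.comp_apply, LinearEquiv.coe_coe, Basis.equiv_apply]
    exact ab_eq i
  have hdet : LinearMap.det f = ∏ i, a i := by
    rw [← LinearMap.det_toMatrix b', ← Matrix.det_diagonal]
    congr 1
    ext i j
    rw [LinearMap.toMatrix_apply, ha, map_smul, Basis.repr_self, Finsupp.smul_single,
      smul_eq_mul, mul_one, Matrix.diagonal_apply, Finsupp.single_apply]
    split_ifs <;> simp_all
  have hnorm : ‖b.det ((↑) ∘ bN)‖ = ‖∏ i, a i‖ := by
    have hb : b.det ((↑) ∘ bN) =
        LinearMap.det (N.subtype ∘ₗ (b.equiv bN (Equiv.refl _)).toLinearMap) := by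
      rw [← Basis.det_comp_basis]
      rfl
    obtain ⟨u, hu⟩ := LinearMap.associated_det_comp_equiv N.subtype (b.equiv bN (Equiv.refl _))
      (b'.equiv ab (Equiv.refl _))
    rw [hb, ← hdet, ← hu, norm_mul, PadicInt.norm_units, mul_one]
  have hq (i) := PadicInt.card_quotient_span_singleton (smithNormalFormCoeffs_ne_zero b h i)
  have := fun i ↦ (hq i).1
  let e := N.quotientEquivPiSpan b h
  refine ⟨Finite.of_equiv _ e.symm.toEquiv, ?_⟩
  rw [hnorm, Nat.card_congr e.toEquiv, Nat.card_pi, norm_prod, Nat.cast_prod,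
    ← Finset.prod_inv_distrib]
  exact Finset.prod_congr rfl fun i _ ↦ (hq i).2

open Module in
/-- The index of a sublattice of a lattice in a `ℚ_[p]`-vector space, as the inverse of the norm of
a determinant over `ℚ_[p]`. -/
theorem Submodule.card_quotient_comap_subtype_eq_norm_det {p : ℕ} [Fact p.Prime]
    {Y : Type*} [AddCommGroup Y] [Module ℚ_[p] Y] [Module ℤ_[p] Y] [IsScalarTower ℤ_[p] ℚ_[p] Y]
    {ι : Type*} [Fintype ι] [DecidableEq ι] (L N : Submodule ℤ_[p] Y) [L.IsLattice ℚ_[p]]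
    (hN : N ≤ L) (b : Basis ι ℤ_[p] L) (bN : Basis ι ℤ_[p] N) :
    Finite (L ⧸ N.comap L.subtype) ∧
      ‖(b.extendOfIsLattice ℚ_[p]).det fun i ↦ (bN i : Y)‖ =
        (Nat.card (L ⧸ N.comap L.subtype) : ℝ)⁻¹ := by
  let bN' := bN.map (Submodule.comapSubtypeEquivOfLe hN).symm
  have hrepr (x : L) (i : ι) :
      (b.extendOfIsLattice ℚ_[p]).repr (x : Y) i = (b.repr x i : ℚ_[p]) := by
    have hx : (x : Y) = ∑ j, (b.repr x j : ℚ_[p]) • b.extendOfIsLattice ℚ_[p] j := by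
      conv_lhs => rw [← b.sum_repr x]
      simp only [Basis.extendOfIsLattice_apply, AddSubmonoidClass.coe_finsetSum,
        Submodule.coe_smul]
      exact Finset.sum_congr rfl fun j _ ↦ (algebraMap_smul ℚ_[p] (b.repr x j) (b j : Y)).symm
    rw [hx, Basis.repr_sum_self]
  have hdet : ((b.extendOfIsLattice ℚ_[p]).det fun i ↦ (bN i : Y)) =
      (b.det ((↑) ∘ bN') : ℚ_[p]) := by
    change _ = PadicInt.Coe.ringHom _
    rw [Basis.det_apply, Basis.det_apply, RingHom.map_det]
    congr 1
    ext i j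
    exact hrepr (bN' j) i
  obtain ⟨hfin, hcard⟩ := card_quotient_eq_norm_det_basis_change b _ bN'
  exact ⟨hfin, by rw [hdet, ← hcard]; rfl⟩

/-- **Lemma 2.1 (Milne / linear algebra lemma).**
Let `Y` be a finite-dimensional `ℚ_[p]`-vector space and `F : Y ≃ₗ[ℚ_[p]] Y` a linear
automorphism.  Suppose `L' ⊆ L ⊆ Y` are `ℤ_[p]`-lattices (finitely generated
`ℤ_[p]`-submodules spanning `Y` over `ℚ_[p]`) such that `F` maps `L'` into `L`.
Then `L / F(L')` and `L / L'` are finite, and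
`|det F|_p = |L / F(L')|⁻¹ * |L / L'|`. -/
theorem milne_lemma_2_1 (p : ℕ) [Fact p.Prime]
    (Y : Type*) [AddCommGroup Y] [Module ℚ_[p] Y] [FiniteDimensional ℚ_[p] Y]
    [Module ℤ_[p] Y] [IsScalarTower ℤ_[p] ℚ_[p] Y]
    (F : Y ≃ₗ[ℚ_[p]] Y)
    (L L' : Submodule ℤ_[p] Y)
    (hLfg : L.FG) (hL'fg : L'.FG)
    (hLspan : Submodule.span ℚ_[p] (L : Set Y) = ⊤)
    (hL'span : Submodule.span ℚ_[p] (L' : Set Y) = ⊤)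
    (hsub : L' ≤ L)
    (hF : ∀ x ∈ L', F x ∈ L) :
    Finite (L ⧸ ((L'.map (F.toLinearMap.restrictScalars ℤ_[p])).comap L.subtype)) ∧
    Finite (L ⧸ (L'.comap L.subtype)) ∧
    ‖LinearMap.det F.toLinearMap‖ =
      (Nat.card
        (L ⧸ ((L'.map (F.toLinearMap.restrictScalars ℤ_[p])).comap L.subtype)) : ℝ)⁻¹ *
      (Nat.card (L ⧸ (L'.comap L.subtype)) : ℝ) := by
  have : L.IsLattice ℚ_[p] := ⟨hLfg, hLspan⟩
  have : L'.IsLattice ℚ_[p] := ⟨hL'fg, hL'span⟩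
  let b := (Module.Free.chooseBasis ℤ_[p] L).reindex
    ((Module.Free.chooseBasis ℤ_[p] L).extendOfIsLattice ℚ_[p] |>.indexEquiv
      ((Module.Free.chooseBasis ℤ_[p] L').extendOfIsLattice ℚ_[p]))
  let c := Module.Free.chooseBasis ℤ_[p] L'
  let FZ := F.toLinearMap.restrictScalars ℤ_[p]
  have hFL' : L'.map FZ ≤ L := Submodule.map_le_iff_le_comap.mpr hF
  let cF := c.map (Submodule.equivMapOfInjective FZ F.injective L')
  obtain ⟨hfin, hcard⟩ := L.card_quotient_comap_subtype_eq_norm_det L' hsub b c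
  obtain ⟨hfinF, hcardF⟩ := L.card_quotient_comap_subtype_eq_norm_det (L'.map FZ) hFL' b cF
  refine ⟨hfinF, hfin, ?_⟩
  have hdet : ((b.extendOfIsLattice ℚ_[p]).det fun i ↦ (cF i : Y)) =
      LinearMap.det F.toLinearMap * (b.extendOfIsLattice ℚ_[p]).det fun i ↦ (c i : Y) := by
    rw [← Module.Basis.det_comp]
    rfl
  have hpos : (Nat.card (L ⧸ L'.comap L.subtype) : ℝ) ≠ 0 :=
    Nat.cast_ne_zero.mpr Nat.card_pos.ne'
  rw [hdet, norm_mul, hcard] at hcardF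
  rw [← hcardF, inv_mul_cancel_right₀ hpos]
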